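/- There exist absolute positive constants c₉, c₁₀, c₁₁ such that the following holds. Let τ > 0 and let ξ be a real random variable with E ξ = 0 and Var ξ = σ² > 0 whose distribution F belongs to the class A₁(τ), and suppose τ/σ ≤ c₉. Then for every x with 2σ ≤ x ≤ c₁₀ σ²/τ, setting β(x) = c₁₁ τ x² σ^{−2}, one has 1 − Φ(x + β(x)) ≤ 1 − F(x) ≤ 1 − Φ(x − β(x)), where F(·) is the distribution function of F and Φ(·) is the distribution function of the Gaussian law with mean 0 and variance σ². -/

import Mathlib

open MeasureTheory ProbabilityTheory

noncomputable section

/-- `φ` is the cumulant generating function (analytic logarithm of the Laplace transform,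
normalized by `φ 0 = 0`) of `μ` on the disc `{z : ‖z‖ * τ < 1}`, with third derivative
bounded by `τ · Var μ`.  This is the defining property of the class `A₁(τ)`. -/
def IsCGF (φ : ℂ → ℂ) (τ : ℝ) (μ : Measure ℝ) : Prop :=
  φ 0 = 0 ∧ ∀ z : ℂ, ‖z‖ * τ < 1 →
    Integrable (fun x : ℝ => Complex.exp (z * x)) μ ∧
    Complex.exp (φ z) = ∫ x : ℝ, Complex.exp (z * x) ∂μ ∧
    AnalyticAt ℂ φ z ∧
    ‖iteratedDeriv 3 φ z‖ ≤ τ * variance id μ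

/-- The class `A₁(τ)` of distributions on `ℝ`. -/
def MemA1 (τ : ℝ) (μ : Measure ℝ) : Prop := ∃ φ : ℂ → ℂ, IsCGF φ τ μ

/-- `π` is a coupling of `F` and `G`. -/
def IsCoupling (π : Measure (ℝ × ℝ)) (F G : Measure ℝ) : Prop :=
  π.map Prod.fst = F ∧ π.map Prod.snd = G

section
open scoped FourierTransform SchwartzMap
lemma kernel_exists : ∃ (k : ℝ → ℂ) (M C : ℝ) (S₀ : ℂ), 0 < M ∧ 0 < C ∧ Continuous k ∧
    (∀ s, ‖k s‖ ≤ M) ∧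
    ∀ v : ℝ, ‖S₀ + (∫ s in (-(1/7):ℝ)..(1/7), k s * ∫ y in (0:ℝ)..v, Complex.exp (-(2 * Real.pi * s * y : ℝ) * Complex.I))
      - (if 0 < v then 1 else 0)‖ ≤ C / (1 + v^2) := by
  let f : ContDiffBump (0:ℝ) := ⟨1/14, 1/7, by norm_num, by norm_num⟩
  let k : ℝ → ℂ := fun s => (f s : ℂ)
  have hkc : HasCompactSupport k := f.hasCompactSupport.comp_left (g := fun x : ℝ => (x:ℂ)) (by simp)
  have hks : ContDiff ℝ (⊤ : ℕ∞) k := Complex.ofRealCLM.contDiff.comp (f.contDiff (n := ⊤))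
  let kk : 𝓢(ℝ, ℂ) := hkc.toSchwartzMap hks
  have hkk : (kk : ℝ → ℂ) = k := rfl
  let K : 𝓢(ℝ, ℂ) := 𝓕 kk
  have hKc : (K : ℝ → ℂ) = 𝓕 k := by
    simp only [K, SchwartzMap.fourier_coe]; rfl
  have hk0 : ∀ s, 1/7 < |s| → k s = 0 := by
    intro s hs
    have : f s = 0 := f.zero_of_le_dist (by rw [Real.dist_eq, sub_zero]; exact hs.le)
    simp [k, this]
  have hKdef : ∀ y, K y = ∫ s in (-(1/7):ℝ)..(1/7), k s * Complex.exp (-(2 * Real.pi * s * y : ℝ) * Complex.I) := by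
    intro y
    rw [hKc, Real.fourier_eq', intervalIntegral.integral_of_le (by norm_num), ← integral_Icc_eq_integral_Ioc]
    rw [setIntegral_eq_integral_of_forall_compl_eq_zero]
    · congr 1; ext s
      rw [smul_eq_mul, mul_comm]
      congr 2
      simp; ring
    · intro s hs
      rw [hk0 s, zero_mul]
      by_contra h
      exact hs (abs_le.mp (not_lt.mp h))
  have hKint : Integrable K := K.integrable
  have hK1 : ∫ y, K y = 1 := by
    have h := congrFun (Continuous.fourierInv_fourier_eq (f := k) hks.continuous kk.integrable
      (hKc ▸ hKint)) 0
    rw [Real.fourierInv_eq'] at h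
    have h2 : k 0 = 1 := by
      have : f 0 = 1 := f.one_of_mem_closedBall (by simp [f])
      simp [k, this]
    rw [h2] at h
    rw [← h, hKc]; congr 1; ext y; simp
  have hK2 : Integrable (fun y => (1 + y^2) * ‖K y‖) := by
    have := hKint.norm.add (K.integrable_pow_mul volume 2)
    refine this.congr (Filter.Eventually.of_forall fun y => ?_)
    simp; ring
  set D := ∫ y, (1 + y^2) * ‖K y‖ with hD
  have hD0 : 0 ≤ D := integral_nonneg fun y => by positivity
  have hB : ∀ v, (∫ s in (-(1/7):ℝ)..(1/7), k s * ∫ y in (0:ℝ)..v, Complex.exp (-(2 * Real.pi * s * y : ℝ) * Complex.I)) = ∫ y in (0:ℝ)..v, K y := by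
    intro v
    simp_rw [hKdef, ← intervalIntegral.integral_const_mul]
    rw [intervalIntegral_intervalIntegral_swap]
    have hc := hks.continuous
    refine IntegrableOn.mono_set (t := Set.uIcc (-(1/7):ℝ) (1/7) ×ˢ Set.uIcc 0 v) ?_
      (Set.prod_mono Set.uIoc_subset_uIcc Set.uIoc_subset_uIcc)
    apply ContinuousOn.integrableOn_compact (isCompact_uIcc.prod isCompact_uIcc)
    apply Continuous.continuousOn
    unfold Function.uncurry
    fun_prop
  refine ⟨k, 1, D + 1, ∫ y in Set.Iic 0, K y, by norm_num, by positivity, hks.continuous, ?_, ?_⟩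
  · intro s
    simp only [k, Complex.norm_real, Real.norm_eq_abs, abs_of_nonneg f.nonneg]
    exact f.le_one
  intro v
  rw [hB, ← intervalIntegral.integral_Iic_sub_Iic hKint.integrableOn hKint.integrableOn, add_sub_cancel]
  have key : ∀ s : Set ℝ, MeasurableSet s → (∀ y ∈ s, v^2 ≤ y^2) → ‖∫ y in s, K y‖ ≤ (D+1) / (1+v^2) := by
    intro s hs hsv
    rw [le_div_iff₀ (by positivity)]
    calc ‖∫ y in s, K y‖ * (1+v^2) ≤ (∫ y in s, ‖K y‖) * (1+v^2) := by
          gcongr; exact norm_integral_le_integral_norm _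
      _ = ∫ y in s, (1+v^2) * ‖K y‖ := by rw [integral_const_mul, mul_comm]
      _ ≤ ∫ y in s, (1+y^2) * ‖K y‖ := by
          apply setIntegral_mono_on (hKint.norm.const_mul _).integrableOn hK2.integrableOn hs
          intro y hy
          have := hsv y hy
          gcongr
      _ ≤ D := setIntegral_le_integral hK2 (Filter.Eventually.of_forall fun y => by positivity)
      _ ≤ D + 1 := by linarith
  split_ifs with h
  · have : (∫ y in Set.Iic v, K y) - 1 = -∫ y in Set.Ioi v, K y := by
      rw [← hK1, ← intervalIntegral.integral_Iic_add_Ioi (b := v) hKint.integrableOn hKint.integrableOn]; ring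
    rw [this, norm_neg]
    apply key _ measurableSet_Ioi
    intro y hy
    have : v < y := hy
    gcongr
  · rw [sub_zero]
    apply key _ measurableSet_Iic
    intro y hy
    have : y ≤ v := hy
    nlinarith

lemma fejer_closed (v : ℝ) :
    (∫ s in (-1:ℝ)..1, ((1 - |s| : ℝ) : ℂ) * Complex.exp ((s * v : ℝ) * Complex.I)) * (v:ℂ)^2 = ((2 * (1 - Real.cos v) : ℝ) : ℂ) := by
  have hcont : Continuous fun s : ℝ => ((1 - |s| : ℝ) : ℂ) * Complex.exp ((s * v : ℝ) * Complex.I) := by fun_prop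
  rw [← intervalIntegral.integral_add_adjacent_intervals (b := 0) (hcont.intervalIntegrable _ _) (hcont.intervalIntegrable _ _)]
  by_cases hv : v = 0
  · simp [hv]
  have hv' : (v:ℂ) ≠ 0 := by exact_mod_cast hv
  have e : ∀ s : ℝ, HasDerivAt (fun s : ℝ => Complex.exp ((s * v : ℝ) * Complex.I)) (Complex.exp ((s * v : ℝ) * Complex.I) * (v * Complex.I)) s := by
    intro s
    have : HasDerivAt (fun s : ℝ => ((s * v : ℝ):ℂ) * Complex.I) (v * Complex.I) s := by
      have := ((hasDerivAt_id s).mul_const v).ofReal_comp.mul_const Complex.I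
      simpa using this
    exact this.cexp
  have hid : ∀ s : ℝ, HasDerivAt (fun s : ℝ => (s:ℂ)) 1 s := fun s => (hasDerivAt_id s).ofReal_comp
  have hI := Complex.I_sq
  have h1 : ∫ s in (0:ℝ)..1, ((1 - |s| : ℝ) : ℂ) * Complex.exp ((s * v : ℝ) * Complex.I)
     = ((1 - (1:ℝ)) * Complex.exp ((1 * v : ℝ) * Complex.I) / (v * Complex.I) - Complex.exp ((1 * v : ℝ) * Complex.I) / v^2)
      - ((1 - (0:ℝ)) * Complex.exp ((0 * v : ℝ) * Complex.I) / (v * Complex.I) - Complex.exp ((0 * v : ℝ) * Complex.I) / v^2) := by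
    rw [intervalIntegral.integral_congr (g := fun s : ℝ => (1 - (s:ℂ)) * Complex.exp ((s * v : ℝ) * Complex.I))]
    · apply intervalIntegral.integral_eq_sub_of_hasDerivAt (f := fun s : ℝ => (1 - (s:ℂ)) * Complex.exp ((s * v : ℝ) * Complex.I) / (v * Complex.I) - Complex.exp ((s * v : ℝ) * Complex.I) / v^2)
      · intro s _
        have := ((((hid s).const_sub 1).mul (e s)).div_const (v * Complex.I)).sub ((e s).div_const ((v:ℂ)^2))
        refine HasDerivAt.congr_deriv this ?_
        generalize Complex.exp ((s * v : ℝ) * Complex.I) = z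
        field_simp [Complex.I_ne_zero]
        linear_combination -z * hI
      · exact Continuous.intervalIntegrable (by fun_prop) _ _
    · intro s hs
      rw [Set.uIcc_of_le zero_le_one] at hs
      simp [abs_of_nonneg hs.1]
  have h2 : ∫ s in (-1:ℝ)..0, ((1 - |s| : ℝ) : ℂ) * Complex.exp ((s * v : ℝ) * Complex.I)
     = ((1 + (0:ℝ)) * Complex.exp ((0 * v : ℝ) * Complex.I) / (v * Complex.I) + Complex.exp ((0 * v : ℝ) * Complex.I) / v^2)
      - ((1 + (-1:ℝ)) * Complex.exp ((-1 * v : ℝ) * Complex.I) / (v * Complex.I) + Complex.exp ((-1 * v : ℝ) * Complex.I) / v^2) := by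
    rw [intervalIntegral.integral_congr (g := fun s : ℝ => (1 + (s:ℂ)) * Complex.exp ((s * v : ℝ) * Complex.I))]
    · have := intervalIntegral.integral_eq_sub_of_hasDerivAt (f := fun s : ℝ => (1 + (s:ℂ)) * Complex.exp ((s * v : ℝ) * Complex.I) / (v * Complex.I) + Complex.exp ((s * v : ℝ) * Complex.I) / v^2) (f' := fun s : ℝ => (1 + (s:ℂ)) * Complex.exp ((s * v : ℝ) * Complex.I)) (a := -1) (b := 0) ?_ ?_
      · rw [this]
      · intro s _
        have := ((((hid s).const_add 1).mul (e s)).div_const (v * Complex.I)).add ((e s).div_const ((v:ℂ)^2))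
        refine HasDerivAt.congr_deriv this ?_
        generalize Complex.exp ((s * v : ℝ) * Complex.I) = z
        field_simp [Complex.I_ne_zero]
        linear_combination z * hI
      · exact Continuous.intervalIntegrable (by fun_prop) _ _
    · intro s hs
      rw [Set.uIcc_of_le (by norm_num)] at hs
      simp [abs_of_nonpos hs.2]
  rw [h1, h2]
  have hc : (Real.cos v : ℂ) = (Complex.exp (v * Complex.I) + Complex.exp (-v * Complex.I))/2 := by
    rw [Complex.ofReal_cos, Complex.cos]
  push_cast
  push_cast at hc
  rw [hc]
  simp
  field_simp [Complex.I_ne_zero]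
  ring

end

def fejerJ (v : ℝ) : ℂ := ∫ s in (-1:ℝ)..1, ((1 - |s| : ℝ) : ℂ) * Complex.exp ((s * v : ℝ) * Complex.I)

lemma fejerJ_re (v : ℝ) : (fejerJ v).re * v^2 = 2 * (1 - Real.cos v) := by
  have h := congrArg Complex.re (fejer_closed v)
  rw [← Complex.ofReal_pow, Complex.re_mul_ofReal, Complex.ofReal_re] at h
  exact h

lemma fejerJ_re_nonneg (v : ℝ) : 0 ≤ (fejerJ v).re := by
  by_cases hv : v = 0
  · subst hv
    have : fejerJ 0 = ((∫ s in (-1:ℝ)..1, (1 - |s|) : ℝ) : ℂ) := by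
      rw [← intervalIntegral.integral_ofReal]
      simp [fejerJ]
    rw [this, Complex.ofReal_re]
    apply intervalIntegral.integral_nonneg (by norm_num)
    intro s hs
    have := abs_le.mpr hs
    linarith
  · have h := fejerJ_re v
    have h2 : 0 < v^2 := by positivity
    have := Real.cos_le_one v
    by_contra hn
    nlinarith

lemma fejer_lower (v : ℝ) : 2 - 2 * Real.cos (1/2) ≤ (fejerJ v + fejerJ (v+1)).re * (1 + v^2) := by
  have h1 := fejerJ_re v
  have h2 := fejerJ_re (v+1)
  have h3 := fejerJ_re_nonneg v
  have h4 := fejerJ_re_nonneg (v+1)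
  have h5 : Real.cos v + Real.cos (v+1) ≤ 2 * Real.cos (1/2) := by
    rw [Real.cos_add_cos]
    have a1 : (v - (v+1))/2 = -(1/2) := by ring
    rw [a1, Real.cos_neg]
    have a2 : 0 < Real.cos (1/2) := Real.cos_pos_of_mem_Ioo ⟨by linarith [Real.pi_gt_three], by linarith [Real.pi_gt_three]⟩
    have a3 := Real.cos_le_one ((v + (v+1))/2)
    nlinarith
  rw [Complex.add_re]
  nlinarith [mul_nonneg h4 (sq_nonneg (v-1))]

lemma conc_bound : ∃ C : ℝ, 0 < C ∧ ∀ (G : Measure ℝ) [IsProbabilityMeasure G] (T a : ℝ),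
    ∫ v, 1 / (1 + (T * (v - a))^2) ∂G ≤ C * ∫ s in (-1:ℝ)..1, ‖charFun G (T * s)‖ := by
  set c := 2 - 2 * Real.cos (1/2) with hc
  have hc0 : 0 < c := by
    have : Real.cos (1/2) < 1 := by
      have := Real.cos_lt_cos_of_nonneg_of_le_pi (x := 0) (y := 1/2) le_rfl (by linarith [Real.pi_gt_three]) (by norm_num)
      simpa using this
    linarith
  refine ⟨2 / c, by positivity, ?_⟩
  intro G _ T a
  let w : ℝ → ℂ := fun s => ((1 - |s| : ℝ) : ℂ) * (1 + Complex.exp ((s:ℝ) * Complex.I))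
  have hw : Continuous w := by fun_prop
  have hJ : ∀ u : ℝ, fejerJ u + fejerJ (u+1) = ∫ s in (-1:ℝ)..1, w s * Complex.exp ((s * u : ℝ) * Complex.I) := by
    intro u
    rw [fejerJ, fejerJ, ← intervalIntegral.integral_add]
    · congr 1; ext s
      simp only [w]
      have : Complex.exp ((s * (u+1) : ℝ) * Complex.I) = Complex.exp ((s * u : ℝ) * Complex.I) * Complex.exp ((s:ℝ) * Complex.I) := by
        rw [← Complex.exp_add]; congr 1; push_cast; ring
      rw [this]; ring
    · exact Continuous.intervalIntegrable (by fun_prop) _ _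
    · exact Continuous.intervalIntegrable (by fun_prop) _ _
  have hwb : ∀ s ∈ Set.uIoc (-1:ℝ) 1, ‖w s‖ ≤ 2 := by
    intro s hs
    rw [Set.uIoc_of_le (by norm_num)] at hs
    have h1 : |s| ≤ 1 := abs_le.mpr ⟨hs.1.le, hs.2⟩
    simp only [w, norm_mul, Complex.norm_real, Real.norm_eq_abs]
    have h2 : ‖(1:ℂ) + Complex.exp ((s:ℝ) * Complex.I)‖ ≤ 2 := by
      refine (norm_add_le _ _).trans ?_
      rw [Complex.norm_exp_ofReal_mul_I]; norm_num
    have h3 : abs (1 - abs s) ≤ 1 := by rw [abs_le]; constructor <;> linarith [abs_nonneg s]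
    nlinarith [abs_nonneg (1 - abs s), norm_nonneg ((1:ℂ) + Complex.exp ((s:ℝ) * Complex.I))]
  have hint : Integrable (Function.uncurry fun (s v : ℝ) => w s * Complex.exp ((s * (T * (v - a)) : ℝ) * Complex.I))
      ((volume.restrict (Set.uIoc (-1:ℝ) 1)).prod G) := by
    haveI : IsFiniteMeasure (volume.restrict (Set.uIoc (-1:ℝ) 1)) := ⟨by simp⟩
    apply Integrable.of_bound (C := 2)
    · apply Continuous.aestronglyMeasurable
      unfold Function.uncurry
      fun_prop
    · have hm : ∀ᵐ s ∂(volume.restrict (Set.uIoc (-1:ℝ) 1)), ‖w s‖ ≤ 2 := by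
        filter_upwards [ae_restrict_mem measurableSet_uIoc] with s hs using hwb s hs
      have := (Measure.quasiMeasurePreserving_fst (μ := volume.restrict (Set.uIoc (-1:ℝ) 1)) (ν := G)).ae hm
      filter_upwards [this] with p hp
      simp only [Function.uncurry]
      rw [norm_mul, Complex.norm_exp_ofReal_mul_I, mul_one]; exact hp
  have hswap : ∫ v, (fejerJ (T*(v-a)) + fejerJ (T*(v-a)+1)) ∂G
     = ∫ s in (-1:ℝ)..1, w s * Complex.exp (-(s * T * a : ℝ) * Complex.I) * charFun G (T * s) := by
    simp_rw [hJ]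
    rw [← intervalIntegral_integral_swap hint]
    congr 1; ext s
    rw [charFun_apply_real, ← integral_const_mul]
    congr 1; ext v
    rw [mul_assoc (w s), ← Complex.exp_add]
    congr 2; push_cast; ring
  have hI : Integrable (fun v => fejerJ (T*(v-a)) + fejerJ (T*(v-a)+1)) G := by
    simp_rw [hJ]
    have := hint.integral_prod_right
    refine this.congr (Filter.Eventually.of_forall fun v => ?_)
    simp only [Function.uncurry, Set.uIoc_of_le (show (-1:ℝ) ≤ 1 by norm_num)]
    rw [intervalIntegral.integral_of_le (by norm_num)]
  calc ∫ v, 1 / (1 + (T * (v - a))^2) ∂G ≤ ∫ v, (1/c) * (fejerJ (T*(v-a)) + fejerJ (T*(v-a)+1)).re ∂G := by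
        apply integral_mono
        · apply Integrable.of_bound (C := 1)
          · apply Continuous.aestronglyMeasurable
            apply Continuous.div (by fun_prop) (by fun_prop)
            intro v; positivity
          · refine Filter.Eventually.of_forall fun v => ?_
            rw [Real.norm_eq_abs, abs_of_nonneg (by positivity), div_le_one (by positivity)]
            nlinarith [sq_nonneg (T * (v-a))]
        · exact hI.re.const_mul _
        · intro v
          have := fejer_lower (T*(v-a))
          simp only
          rw [div_mul_eq_mul_div, one_mul, div_le_div_iff₀ (by positivity) hc0]
          linarith
    _ = (1/c) * (∫ v, (fejerJ (T*(v-a)) + fejerJ (T*(v-a)+1)) ∂G).re := by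
        rw [integral_const_mul]
        congr 1
        exact integral_re hI
    _ ≤ (1/c) * ∫ s in (-1:ℝ)..1, 2 * ‖charFun G (T * s)‖ := by
        gcongr
        refine (Complex.re_le_norm _).trans ?_
        rw [hswap]
        refine intervalIntegral.norm_integral_le_of_norm_le (by norm_num) ?_ ?_
        · refine Filter.Eventually.of_forall fun s hs => ?_
          have := hwb s (by rwa [Set.uIoc_of_le (by norm_num)])
          rw [norm_mul, norm_mul, ← Complex.ofReal_neg, Complex.norm_exp_ofReal_mul_I, mul_one]
          gcongr
        · apply IntervalIntegrable.const_mul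
          rw [intervalIntegrable_iff]
          apply Measure.integrableOn_of_bounded (M := 1) (by simp)
          · exact ((measurable_charFun.comp (by fun_prop : Measurable fun s : ℝ => T * s)).norm).aestronglyMeasurable
          · refine Filter.Eventually.of_forall fun s => ?_
            simpa using norm_charFun_le_one (μ := G) (T*s)
    _ = 2 / c * ∫ s in (-1:ℝ)..1, ‖charFun G (T * s)‖ := by
        rw [intervalIntegral.integral_const_mul]; ring

def osc (s u : ℝ) : ℂ := ∫ y in (0:ℝ)..u, Complex.exp (-(2 * Real.pi * s * y : ℝ) * Complex.I)

lemma osc_cont : Continuous (Function.uncurry osc) := by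
  unfold Function.uncurry osc
  exact intervalIntegral.continuous_parametric_intervalIntegral_of_continuous
    (f := fun (p : ℝ × ℝ) (y : ℝ) => Complex.exp (-(2 * Real.pi * p.1 * y : ℝ) * Complex.I))
    (by unfold Function.uncurry; fun_prop) (by fun_prop)

lemma osc_norm (s u : ℝ) : ‖osc s u‖ ≤ |u| := by
  have := intervalIntegral.norm_integral_le_of_norm_le_const (a := 0) (b := u) (C := 1)
    (f := fun y : ℝ => Complex.exp (-(2 * Real.pi * s * y : ℝ) * Complex.I)) (by
      intro y _
      rw [← Complex.ofReal_neg, Complex.norm_exp_ofReal_mul_I])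
  simpa [osc] using this

lemma osc_eq (s u : ℝ) (hs : s ≠ 0) : osc s u =
    (1 - Complex.exp (-(2 * Real.pi * s * u : ℝ) * Complex.I)) / (2 * Real.pi * s * Complex.I) := by
  have hpi : (Real.pi : ℂ) ≠ 0 := by exact_mod_cast Real.pi_ne_zero
  have hs' : (s : ℂ) ≠ 0 := by exact_mod_cast hs
  have h := integral_exp_mul_complex (a := 0) (b := u) (c := -(2 * Real.pi * s * Complex.I)) (by
    simp [hpi, hs', Complex.I_ne_zero])
  unfold osc
  rw [show (fun y : ℝ => Complex.exp (-(2 * Real.pi * s * y : ℝ) * Complex.I)) = fun y : ℝ => Complex.exp (-(2 * Real.pi * s * Complex.I) * y) by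
    ext y; congr 1; push_cast; ring]
  rw [h]
  have : Complex.exp (-(2 * Real.pi * s * u : ℝ) * Complex.I) = Complex.exp (-(2 * Real.pi * s * Complex.I) * u) := by
    congr 1; push_cast; ring
  rw [this]
  simp
  rw [div_neg, ← neg_div]
  congr 1; ring

lemma osc_integral (H : Measure ℝ) [IsProbabilityMeasure H] (s T a : ℝ) (hs : s ≠ 0) :
    ∫ v, osc s (T * (v - a)) ∂H = (1 - Complex.exp ((2 * Real.pi * s * T * a : ℝ) * Complex.I) * charFun H (-(2 * Real.pi * s * T))) / (2 * Real.pi * s * Complex.I) := by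
  simp_rw [osc_eq s _ hs]
  rw [integral_div, integral_sub (by simp) ?_]
  · rw [charFun_apply_real, ← integral_const_mul]
    simp only [integral_const, probReal_univ, one_smul]
    congr 2
    congr 1; ext v
    rw [← Complex.exp_add]
    congr 1; push_cast; ring
  · apply Integrable.of_bound (C := 1) (Continuous.aestronglyMeasurable (by fun_prop))
    refine Filter.Eventually.of_forall fun v => ?_
    rw [← Complex.ofReal_neg, Complex.norm_exp_ofReal_mul_I]

lemma osc_fubini (H : Measure ℝ) [IsProbabilityMeasure H] (hH : Integrable (fun x => x) H) (k : ℝ → ℂ) (hk : Continuous k) (M : ℝ)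
    (hM : ∀ s, ‖k s‖ ≤ M) (T a : ℝ) :
    Integrable (fun v => ∫ s in (-(1/7):ℝ)..(1/7), k s * osc s (T * (v - a))) H ∧
    IntervalIntegrable (fun s => k s * ∫ v, osc s (T * (v - a)) ∂H) volume (-(1/7)) (1/7) ∧
    ∫ v, (∫ s in (-(1/7):ℝ)..(1/7), k s * osc s (T * (v - a))) ∂H =
    ∫ s in (-(1/7):ℝ)..(1/7), k s * ∫ v, osc s (T * (v - a)) ∂H := by
  have hM0 : 0 ≤ M := (norm_nonneg _).trans (hM 0)
  have : IsFiniteMeasure (volume.restrict (Set.uIoc (-(1/7):ℝ) (1/7))) := ⟨by simp⟩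
  have hint : Integrable (Function.uncurry fun (s v : ℝ) => k s * osc s (T * (v - a)))
      ((volume.restrict (Set.uIoc (-(1/7):ℝ) (1/7))).prod H) := by
    have h1 : Integrable (fun v => M * |T * (v - a)|) H :=
      ((hH.sub (integrable_const a)).const_mul T).norm.const_mul M
    have h2 : Integrable (fun p : ℝ × ℝ => M * |T * (p.2 - a)|) ((volume.restrict (Set.uIoc (-(1/7):ℝ) (1/7))).prod H) := h1.comp_snd _
    apply h2.mono'
    · apply Continuous.aestronglyMeasurable
      have : Continuous fun p : ℝ × ℝ => osc p.1 (T * (p.2 - a)) :=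
        osc_cont.comp (f := fun p : ℝ × ℝ => (p.1, T * (p.2 - a))) (by fun_prop)
      unfold Function.uncurry
      fun_prop
    · refine Filter.Eventually.of_forall fun p => ?_
      simp only [Function.uncurry, norm_mul]
      exact mul_le_mul (hM _) (osc_norm _ _) (norm_nonneg _) hM0
  refine ⟨?_, ?_, ?_⟩
  · refine hint.integral_prod_right.congr (Filter.Eventually.of_forall fun v => ?_)
    simp only [Function.uncurry, Set.uIoc_of_le (show (-(1/7):ℝ) ≤ 1/7 by norm_num)]
    rw [intervalIntegral.integral_of_le (by norm_num)]
  · rw [intervalIntegrable_iff]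
    refine hint.integral_prod_left.congr (Filter.Eventually.of_forall fun s => ?_)
    simp only [Function.uncurry]
    rw [integral_const_mul]
  · rw [← intervalIntegral_integral_swap hint]
    simp_rw [integral_const_mul]

lemma scaled_integral_le (f : ℝ → ℝ) (hf : Integrable f) (h0 : ∀ x, 0 ≤ f x) (c r : ℝ) (hc : 0 < c) (hr : 0 ≤ r) :
    ∫ s in (-r)..r, f (c * s) ≤ (∫ t, f t) / c := by
  rw [intervalIntegral.integral_comp_mul_left f hc.ne', smul_eq_mul, div_eq_inv_mul]
  gcongr
  rw [intervalIntegral.integral_of_le (by nlinarith)]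
  exact setIntegral_le_integral hf (Filter.Eventually.of_forall h0)

lemma integrable_sq_gauss : Integrable (fun t : ℝ => t^2 * Real.exp (-t^2/4)) := by
  have := integrable_rpow_mul_exp_neg_mul_sq (b := 1/4) (by norm_num) (s := 2) (by norm_num)
  refine this.congr (Filter.Eventually.of_forall fun t => ?_)
  simp only [Real.rpow_two]
  congr 2; ring

lemma integrable_gauss4 : Integrable (fun t : ℝ => Real.exp (-t^2/4)) := by
  have := integrable_exp_neg_mul_sq (b := 1/4) (by norm_num)
  refine this.congr (Filter.Eventually.of_forall fun t => ?_)
  simp only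
  congr 1; ring

lemma conc_gauss : ∃ C : ℝ, 0 < C ∧ ∀ (G : Measure ℝ) [IsProbabilityMeasure G] (T a : ℝ), 0 < T →
    (∀ t, |t| ≤ T → ‖charFun G t‖ ≤ (1 + t^2) * Real.exp (-t^2/4)) →
    ∫ v, 1 / (1 + (T * (v - a))^2) ∂G ≤ C / T := by
  obtain ⟨C, hC, h⟩ := conc_bound
  let f : ℝ → ℝ := fun t => (1 + t^2) * Real.exp (-t^2/4)
  have hf : Integrable f := by
    refine (integrable_gauss4.add integrable_sq_gauss).congr (Filter.Eventually.of_forall fun t => ?_)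
    simp [f]; ring
  have hf0 : ∀ t, 0 ≤ f t := fun t => by positivity
  refine ⟨C * (∫ t, f t) + 1, by have := integral_nonneg (μ := volume) (f := f) hf0; positivity, ?_⟩
  intro G _ T a hT hG
  refine (h G T a).trans ?_
  have h1 : ∫ s in (-1:ℝ)..1, ‖charFun G (T * s)‖ ≤ ∫ s in (-1:ℝ)..1, f (T * s) := by
    apply intervalIntegral.integral_mono_on (by norm_num)
    · rw [intervalIntegrable_iff]
      apply Measure.integrableOn_of_bounded (M := 1) (by simp)
      · exact ((measurable_charFun.comp (by fun_prop : Measurable fun s : ℝ => T * s)).norm).aestronglyMeasurable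
      · refine Filter.Eventually.of_forall fun s => ?_
        simpa using norm_charFun_le_one (μ := G) (T*s)
    · exact Continuous.intervalIntegrable (by fun_prop) _ _
    · intro s hs
      apply hG
      rw [abs_mul, abs_of_pos hT]
      have := abs_le.mpr hs
      nlinarith
  have h2 := scaled_integral_le f hf hf0 T 1 hT zero_le_one
  calc C * ∫ s in (-1:ℝ)..1, ‖charFun G (T * s)‖ ≤ C * ((∫ t, f t) / T) := by
        gcongr; linarith
    _ ≤ (C * (∫ t, f t) + 1) / T := by
        rw [mul_div_assoc']
        gcongr; linarith

lemma charFun_std (t : ℝ) : charFun (gaussianReal 0 1) t = ((Real.exp (-t^2/2) : ℝ) : ℂ) := by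
  rw [charFun_gaussianReal]
  push_cast
  congr 1; simp; ring

lemma berry_esseen : ∃ C : ℝ, 0 < C ∧ ∀ (G : Measure ℝ) [IsProbabilityMeasure G], Integrable (fun x => x) G →
    ∀ T : ℝ, 0 < T →
    (∀ t, |t| ≤ T → ‖charFun G t - ((Real.exp (-t^2/2) : ℝ) : ℂ)‖ ≤ (1/T) * |t|^3 * Real.exp (-t^2/4)) →
    ∀ a, |G.real (Set.Ioi a) - (gaussianReal 0 1).real (Set.Ioi a)| ≤ C / T := by
  obtain ⟨k, M, C, S₀, hM, hC, hk, hkM, hker⟩ := kernel_exists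
  obtain ⟨C', hC', hconc⟩ := conc_gauss
  set A := ∫ t : ℝ, t^2 * Real.exp (-t^2/4) with hA
  have hA0 : 0 ≤ A := integral_nonneg fun t => by positivity
  refine ⟨2 * (C * C') + M * A, by positivity, ?_⟩
  intro G _ hGi T hT hG a
  set N := gaussianReal 0 1 with hN
  have hNi : Integrable (fun x => x) N := by
    have := (memLp_id_gaussianReal (μ := 0) (v := 1) 1).integrable (by simp)
    exact this
  have hexp : ∀ t : ℝ, Real.exp (-t^2/2) ≤ Real.exp (-t^2/4) := fun t => by
    apply Real.exp_le_exp.mpr; nlinarith [sq_nonneg t]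
  have hGc : ∀ t, |t| ≤ T → ‖charFun G t‖ ≤ (1 + t^2) * Real.exp (-t^2/4) := by
    intro t ht
    have h1 := hG t ht
    have h2 : ‖charFun G t‖ ≤ ‖charFun G t - ((Real.exp (-t^2/2) : ℝ) : ℂ)‖ + ‖((Real.exp (-t^2/2) : ℝ) : ℂ)‖ := by
      have := norm_add_le (charFun G t - ((Real.exp (-t^2/2) : ℝ) : ℂ)) ((Real.exp (-t^2/2) : ℝ) : ℂ)
      rwa [sub_add_cancel] at this
    rw [Complex.norm_real, Real.norm_eq_abs, abs_of_pos (Real.exp_pos _)] at h2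
    have h3 : (1/T) * |t|^3 ≤ t^2 := by
      rw [← sq_abs t, div_mul_eq_mul_div, div_le_iff₀ hT]
      nlinarith [sq_nonneg |t|]
    nlinarith [hexp t, Real.exp_pos (-t^2/4)]
  have hNc : ∀ t, |t| ≤ T → ‖charFun N t‖ ≤ (1 + t^2) * Real.exp (-t^2/4) := by
    intro t ht
    rw [charFun_std, Complex.norm_real, Real.norm_eq_abs, abs_of_pos (Real.exp_pos _)]
    nlinarith [hexp t, Real.exp_pos (-t^2/4), mul_nonneg (sq_nonneg t) (Real.exp_pos (-t^2/4)).le]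
  let S : ℝ → ℂ := fun v => ∫ s in (-(1/7):ℝ)..(1/7), k s * osc s (T * (v - a))
  have hcomp : ∀ (H : Measure ℝ) [IsProbabilityMeasure H], Integrable (fun x => x) H →
     (∀ t, |t| ≤ T → ‖charFun H t‖ ≤ (1 + t^2) * Real.exp (-t^2/4)) →
     ‖S₀ + (∫ v, S v ∂H) - (H.real (Set.Ioi a) : ℂ)‖ ≤ C * C' / T := by
    intro H _ hHi hHc
    have hSi : Integrable S H := (osc_fubini H hHi k hk M hkM T a).1
    have hind : Integrable ((Set.Ioi a).indicator (fun _ => (1:ℂ))) H :=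
      (integrable_const _).indicator measurableSet_Ioi
    have e1 : (H.real (Set.Ioi a) : ℂ) = ∫ v, (Set.Ioi a).indicator (fun _ => (1:ℂ)) v ∂H := by
      rw [integral_indicator measurableSet_Ioi]; simp
    have e2 : S₀ = ∫ v, S₀ ∂H := by simp
    rw [e1]
    nth_rewrite 1 [e2]
    have hadd : Integrable (fun v => S₀ + S v) H := (integrable_const _).add hSi
    rw [← integral_add (integrable_const _) hSi, ← integral_sub hadd hind]
    calc _ ≤ ∫ v, C * (1 / (1 + (T * (v - a))^2)) ∂H := by
          apply norm_integral_le_of_norm_le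
          · apply Integrable.const_mul
            apply Integrable.of_bound (C := 1)
            · apply Continuous.aestronglyMeasurable
              apply Continuous.div (by fun_prop) (by fun_prop)
              intro v; positivity
            · refine Filter.Eventually.of_forall fun v => ?_
              rw [Real.norm_eq_abs, abs_of_nonneg (by positivity), div_le_one (by positivity)]
              nlinarith [sq_nonneg (T * (v-a))]
          · refine Filter.Eventually.of_forall fun v => ?_
            have := hker (T * (v - a))
            rw [mul_one_div]
            have e : (Set.Ioi a).indicator (fun _ => (1:ℂ)) v = if 0 < T * (v - a) then 1 else 0 := by
              simp [Set.indicator, hT]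
            rw [e]
            exact this
      _ = C * ∫ v, (1 / (1 + (T * (v - a))^2)) ∂H := by rw [integral_const_mul]
      _ ≤ C * (C' / T) := by gcongr; exact hconc H T a hT hHc
      _ = C * C' / T := by ring
  have h1 := hcomp G hGi hGc
  have h2 := hcomp N hNi hNc
  have h3 : ‖(∫ v, S v ∂G) - ∫ v, S v ∂N‖ ≤ M * A / T := by
    obtain ⟨_, i1, f1⟩ := osc_fubini G hGi k hk M hkM T a
    obtain ⟨_, i2, f2⟩ := osc_fubini N hNi k hk M hkM T a
    simp only [S]
    rw [f1, f2, ← intervalIntegral.integral_sub i1 i2]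
    have hsc := scaled_integral_le (fun t : ℝ => t^2 * Real.exp (-t^2/4)) integrable_sq_gauss (fun t => by positivity)
      (2 * Real.pi * T) (1/7) (by positivity) (by norm_num)
    calc _ ≤ ∫ s in (-(1/7):ℝ)..(1/7), M * ((fun t : ℝ => t^2 * Real.exp (-t^2/4)) (2 * Real.pi * T * s)) := by
          apply intervalIntegral.norm_integral_le_of_norm_le (by norm_num)
          · have hne : ∀ᵐ s : ℝ, s ≠ 0 := by
              simp [ae_iff]
            filter_upwards [hne] with s hs hmem
            rw [← mul_sub, norm_mul]
            refine mul_le_mul (hkM s) ?_ (norm_nonneg _) hM.le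
            rw [osc_integral G s T a hs, osc_integral N s T a hs, ← sub_div, sub_sub_sub_cancel_left, ← mul_sub, norm_div, norm_mul,
              Complex.norm_exp_ofReal_mul_I, one_mul, norm_sub_rev, hN, charFun_std]
            have hs7 : |s| ≤ 1/7 := abs_le.mpr ⟨hmem.1.le, hmem.2⟩
            have habs : |-(2 * Real.pi * s * T)| = 2 * Real.pi * T * |s| := by
              rw [abs_neg, abs_mul, abs_mul, abs_of_pos hT, abs_of_pos (by positivity : 0 < 2 * Real.pi)]; ring
            have hb := hG (-(2 * Real.pi * s * T)) (by
              rw [habs]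
              have : 2 * Real.pi * |s| ≤ 1 := by nlinarith [Real.pi_lt_d2, abs_nonneg s, Real.pi_pos]
              nlinarith)
            have hs0 : 0 < |s| := abs_pos.mpr hs
            have hnorm : ‖(2 * Real.pi * s * Complex.I : ℂ)‖ = 2 * Real.pi * |s| := by
              simp [abs_of_pos Real.pi_pos]
            rw [hnorm, div_le_iff₀ (by positivity)]
            refine hb.trans (le_of_eq ?_)
            rw [habs]
            have e1 : (-(2 * Real.pi * s * T))^2 = (2 * Real.pi * T * s)^2 := by ring
            simp only [e1]
            have e2 : s^2 = |s|^2 := (sq_abs s).symm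
            have e3 : (2 * Real.pi * T * s)^2 = (2 * Real.pi * T)^2 * |s|^2 := by rw [mul_pow, e2]
            generalize Real.exp _ = z
            rw [e3]
            field_simp
          · exact Continuous.intervalIntegrable (by fun_prop) _ _
      _ = M * ∫ s in (-(1/7):ℝ)..(1/7), ((fun t : ℝ => t^2 * Real.exp (-t^2/4)) (2 * Real.pi * T * s)) := by
          rw [intervalIntegral.integral_const_mul]
      _ ≤ M * (A / (2 * Real.pi * T)) := by gcongr
      _ ≤ M * (A / T) := by
          gcongr
          nlinarith [Real.pi_gt_three]
      _ = M * A / T := by ring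
  rw [← Real.norm_eq_abs, ← Complex.norm_real]
  have : ((G.real (Set.Ioi a) - N.real (Set.Ioi a) : ℝ) : ℂ) =
     -(S₀ + (∫ v, S v ∂G) - (G.real (Set.Ioi a) : ℂ)) + (S₀ + (∫ v, S v ∂N) - (N.real (Set.Ioi a) : ℂ)) + ((∫ v, S v ∂G) - ∫ v, S v ∂N) := by
    push_cast; ring
  rw [this]
  refine (norm_add₃_le).trans ?_
  rw [norm_neg]
  have : (2 * (C * C') + M * A)/T = C * C'/T + C * C'/T + M * A / T := by ring
  linarith

def gQ (κ : ℝ) : ℝ := (gaussianReal 0 1).real (Set.Ioi κ)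

lemma gQ_anti {a b : ℝ} (h : a ≤ b) : gQ b ≤ gQ a :=
  measureReal_mono (Set.Ioi_subset_Ioi h)

def gp (x : ℝ) : ℝ := (Real.sqrt (2 * Real.pi))⁻¹ * Real.exp (-x^2/2)

lemma gp_eq : gaussianPDFReal 0 1 = gp := by
  ext x; simp [gaussianPDFReal_def, gp]

lemma gp_nonneg (x : ℝ) : 0 ≤ gp x := by unfold gp; positivity
lemma gp_int : Integrable gp := by rw [← gp_eq]; exact integrable_gaussianPDFReal 0 1

lemma gQ_eq (κ : ℝ) : gQ κ = ∫ x in Set.Ioi κ, gp x := by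
  rw [gQ, measureReal_def, gaussianReal_apply_eq_integral _ (by norm_num), gp_eq, ENNReal.toReal_ofReal]
  exact setIntegral_nonneg measurableSet_Ioi fun x _ => gp_nonneg x

lemma Ioi_shift (f : ℝ → ℝ) (κ δ : ℝ) : ∫ x in Set.Ioi (κ + δ), f x = ∫ x in Set.Ioi κ, f (x + δ) := by
  rw [← integral_indicator measurableSet_Ioi, ← integral_indicator measurableSet_Ioi,
    ← integral_add_right_eq_self _ δ]
  congr 1; ext x; simp [Set.indicator]

lemma gQ_shift {κ δ : ℝ} (hκ : 0 ≤ κ) (hδ : 0 ≤ δ) : gQ (κ + δ) ≤ Real.exp (-κ*δ) * gQ κ := by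
  rw [gQ_eq, gQ_eq, Ioi_shift, ← integral_const_mul]
  apply setIntegral_mono_on
  · exact (gp_int.comp_add_right δ).integrableOn
  · exact (gp_int.const_mul _).integrableOn
  · exact measurableSet_Ioi
  · intro x hx
    unfold gp
    rw [mul_left_comm, ← Real.exp_add]
    gcongr
    have : κ < x := hx
    nlinarith

lemma gQ_mills : ∃ C : ℝ, 0 < C ∧ ∀ κ : ℝ, 1 ≤ κ → Real.exp (-κ^2/2) ≤ C * κ * gQ κ := by
  refine ⟨Real.sqrt (2 * Real.pi) * Real.exp 2, by positivity, fun κ hκ => ?_⟩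
  have h0 : 0 < κ := by linarith
  have h1 : (1/κ) * ((Real.sqrt (2 * Real.pi))⁻¹ * Real.exp (-κ^2/2 - 2)) ≤ gQ κ := by
    rw [gQ_eq]
    calc _ = ∫ x in Set.Ioc κ (κ + 1/κ), ((Real.sqrt (2 * Real.pi))⁻¹ * Real.exp (-κ^2/2 - 2)) := by
            simp [measureReal_def, h0.le]
      _ ≤ ∫ x in Set.Ioc κ (κ + 1/κ), gp x := by
            apply setIntegral_mono_on
            · exact integrableOn_const (by simp)
            · exact gp_int.integrableOn
            · exact measurableSet_Ioc
            · intro x hx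
              unfold gp
              gcongr
              have hx0 : 0 < x := h0.trans hx.1
              have h2 : x^2 ≤ (κ + 1/κ)^2 := by gcongr; exact hx.2
              have h3 : (κ + 1/κ)^2 = κ^2 + 2 + (1/κ)^2 := by field_simp; ring
              have h4 : 1/κ ≤ 1 := by rw [div_le_one h0]; exact hκ
              have h5 : 0 < 1/κ := by positivity
              nlinarith
      _ ≤ _ := by
            apply setIntegral_mono_set gp_int.integrableOn
            · exact Filter.Eventually.of_forall gp_nonneg
            · exact Set.Ioc_subset_Ioi_self.eventuallyLE
  rw [sub_eq_add_neg, Real.exp_add, Real.exp_neg] at h1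
  have h2 : 0 < Real.sqrt (2 * Real.pi) * Real.exp 2 * κ := by positivity
  calc _ = Real.sqrt (2 * Real.pi) * Real.exp 2 * κ * ((1/κ) * ((Real.sqrt (2 * Real.pi))⁻¹ * (Real.exp (-κ^2/2) * (Real.exp 2)⁻¹))) := by
        field_simp
    _ ≤ _ := by gcongr

lemma gQ_laplace (κ : ℝ) : ∫ w in Set.Ioi 0, Real.exp (-κ*w) ∂(gaussianReal 0 1) = Real.exp (κ^2/2) * gQ κ := by
  have : ∫ w in Set.Ioi (0:ℝ), Real.exp (-κ*w) ∂(gaussianReal 0 1) = ∫ w in Set.Ioi (0:ℝ), gp w * Real.exp (-κ*w) := by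
    rw [← integral_indicator measurableSet_Ioi, integral_gaussianReal_eq_integral_smul (by norm_num), gp_eq, ← integral_indicator measurableSet_Ioi]
    congr 1; ext x; by_cases h : x ∈ Set.Ioi (0:ℝ) <;> simp [Set.indicator, h]
  rw [this, gQ_eq, show κ = 0 + κ by ring, Ioi_shift, ← integral_const_mul]
  congr 1; ext x
  unfold gp
  rw [mul_left_comm, mul_assoc, ← Real.exp_add, ← Real.exp_add]
  congr 2; ring

lemma gQ_pos (κ : ℝ) : 0 < gQ κ := by
  rw [gQ_eq]
  apply (setIntegral_pos_iff_support_of_nonneg_ae (Filter.Eventually.of_forall gp_nonneg) gp_int.integrableOn).mpr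
  have : Function.support gp = Set.univ := by
    ext x; simp [gp]; positivity
  simp [this]

lemma one_sub_cdf (μ : Measure ℝ) [IsProbabilityMeasure μ] (x : ℝ) : 1 - cdf μ x = μ.real (Set.Ioi x) := by
  rw [cdf_eq_real, ← Set.compl_Iic, probReal_compl_eq_one_sub measurableSet_Iic]

lemma gauss_scale {σ : ℝ} (hσ : 0 < σ) (y : ℝ) :
    1 - cdf (gaussianReal 0 (Real.toNNReal (σ ^ 2))) y = gQ (y / σ) := by
  rw [one_sub_cdf, gQ]
  have h := gaussianReal_map_const_mul (μ := 0) (v := 1) σ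
  have e : (⟨σ^2, sq_nonneg σ⟩ : NNReal) * 1 = Real.toNNReal (σ^2) := by
    ext; simp [sq_nonneg]
  rw [mul_zero] at h
  have e2 : gaussianReal 0 (Real.toNNReal (σ^2)) = (gaussianReal 0 1).map (σ * ·) := by
    rw [h]; congr 1; exact e.symm
  rw [e2, map_measureReal_apply (by fun_prop) measurableSet_Ioi]
  congr 1; ext x; simp [div_lt_iff₀ hσ, mul_comm]

lemma laplace_layer (G : Measure ℝ) [IsProbabilityMeasure G] {κ : ℝ} (hκ : 0 < κ) :
    ∫ w in Set.Ioi 0, Real.exp (-κ*w) ∂G = ∫ t in Set.Ioc (0:ℝ) 1, (G.real (Set.Ioi 0) - G.real (Set.Ioi (-Real.log t / κ))) := by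
  rw [← integral_indicator measurableSet_Ioi]
  have hb : ∀ w, 0 ≤ (Set.Ioi (0:ℝ)).indicator (fun w => Real.exp (-κ*w)) w ∧ (Set.Ioi (0:ℝ)).indicator (fun w => Real.exp (-κ*w)) w ≤ 1 := by
    intro w
    by_cases h : w ∈ Set.Ioi (0:ℝ)
    · rw [Set.indicator_of_mem h]
      refine ⟨(Real.exp_pos _).le, Real.exp_le_one_iff.mpr ?_⟩
      have : 0 < w := h
      nlinarith
    · rw [Set.indicator_of_notMem h]; simp
  have hm : Measurable ((Set.Ioi (0:ℝ)).indicator (fun w => Real.exp (-κ*w))) :=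
    Measurable.indicator (by fun_prop) measurableSet_Ioi
  rw [Integrable.integral_eq_integral_Ioc_meas_le (M := 1)]
  · apply setIntegral_congr_fun measurableSet_Ioc
    intro t ht
    simp only
    have hset : {a | t ≤ (Set.Ioi (0:ℝ)).indicator (fun w => Real.exp (-κ*w)) a} = Set.Ioi 0 \ Set.Ioi (-Real.log t / κ) := by
      ext w
      by_cases h : w ∈ Set.Ioi (0:ℝ)
      · simp only [Set.mem_setOf_eq, Set.indicator_of_mem h, Set.mem_sdiff, h, true_and, Set.mem_Ioi, not_lt]
        rw [le_div_iff₀ hκ, ← Real.log_le_iff_le_exp ht.1]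
        constructor <;> intro h <;> linarith
      · simp only [Set.mem_setOf_eq, Set.indicator_of_notMem h, Set.mem_sdiff, h, false_and, iff_false, not_le]
        exact ht.1
    rw [hset, measureReal_sdiff]
    · apply Set.Ioi_subset_Ioi
      have := Real.log_nonpos ht.1.le ht.2
      apply div_nonneg (by linarith) hκ.le
    · exact measurableSet_Ioi
  · apply Integrable.of_bound hm.aestronglyMeasurable 1
    refine Filter.Eventually.of_forall fun w => ?_
    rw [Real.norm_eq_abs, abs_of_nonneg (hb w).1]; exact (hb w).2
  · exact Filter.Eventually.of_forall fun w => (hb w).1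
  · exact Filter.Eventually.of_forall fun w => (hb w).2

lemma laplace_close (G N : Measure ℝ) [IsProbabilityMeasure G] [IsProbabilityMeasure N] {κ η : ℝ} (hκ : 0 < κ)
    (h : ∀ a, |G.real (Set.Ioi a) - N.real (Set.Ioi a)| ≤ η) :
    |∫ w in Set.Ioi 0, Real.exp (-κ*w) ∂G - ∫ w in Set.Ioi 0, Real.exp (-κ*w) ∂N| ≤ 2 * η := by
  have hint : ∀ (H : Measure ℝ) [IsProbabilityMeasure H], IntegrableOn (fun t => H.real (Set.Ioi 0) - H.real (Set.Ioi (-Real.log t / κ))) (Set.Ioc (0:ℝ) 1) := by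
    intro H _
    have hanti : Antitone (fun a => H.real (Set.Ioi a)) := fun a b hab => measureReal_mono (Set.Ioi_subset_Ioi hab)
    have hm : Measurable (fun t : ℝ => H.real (Set.Ioi (-Real.log t / κ))) :=
      hanti.measurable.comp (by fun_prop)
    apply Integrable.of_bound (C := 2) (hm.const_sub _).aestronglyMeasurable
    refine Filter.Eventually.of_forall fun t => ?_
    rw [Real.norm_eq_abs, abs_le]
    have a1 := measureReal_le_one (μ := H) (s := Set.Ioi 0)
    have a2 := measureReal_le_one (μ := H) (s := Set.Ioi (-Real.log t / κ))
    have a3 := measureReal_nonneg (μ := H) (s := Set.Ioi (0:ℝ))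
    have a4 := measureReal_nonneg (μ := H) (s := Set.Ioi (-Real.log t / κ))
    constructor <;> linarith
  rw [laplace_layer G hκ, laplace_layer N hκ, ← integral_sub (hint G) (hint N), ← Real.norm_eq_abs]
  have := norm_setIntegral_le_of_norm_le_const (μ := volume) (s := Set.Ioc (0:ℝ) 1) (C := 2 * η)
    (f := fun t => (G.real (Set.Ioi 0) - G.real (Set.Ioi (-Real.log t / κ))) - (N.real (Set.Ioi 0) - N.real (Set.Ioi (-Real.log t / κ)))) (by simp) (by
      intro t _
      rw [Real.norm_eq_abs]
      have h1 := abs_le.mp (h 0)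
      have h2 := abs_le.mp (h (-Real.log t / κ))
      rw [abs_le]; constructor <;> linarith)
  simpa using this

lemma taylor_cx (φ : ℂ → ℂ) (R K : ℝ) (han : ∀ z ∈ Metric.ball (0:ℂ) R, AnalyticAt ℂ φ z)
    (hK : ∀ z ∈ Metric.ball (0:ℂ) R, ‖deriv (deriv (deriv φ)) z‖ ≤ K) (a z : ℂ)
    (ha : a ∈ Metric.ball (0:ℂ) R) (hz : z ∈ Metric.ball (0:ℂ) R) :
    ‖deriv (deriv φ) z - deriv (deriv φ) a‖ ≤ K * ‖z - a‖ ∧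
    ‖deriv φ z - deriv φ a - deriv (deriv φ) a * (z - a)‖ ≤ K * ‖z - a‖^2 ∧
    ‖φ z - φ a - deriv φ a * (z - a) - deriv (deriv φ) a * (z - a)^2 / 2‖ ≤ K * ‖z - a‖^3 := by
  have hK0 : 0 ≤ K := (norm_nonneg _).trans (hK a ha)
  have d1 : ∀ z ∈ Metric.ball (0:ℂ) R, HasDerivAt φ (deriv φ z) z := fun z hz => (han z hz).differentiableAt.hasDerivAt
  have d2 : ∀ z ∈ Metric.ball (0:ℂ) R, HasDerivAt (deriv φ) (deriv (deriv φ) z) z := fun z hz => (han z hz).deriv.differentiableAt.hasDerivAt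
  have d3 : ∀ z ∈ Metric.ball (0:ℂ) R, HasDerivAt (deriv (deriv φ)) (deriv (deriv (deriv φ)) z) z := fun z hz => (han z hz).deriv.deriv.differentiableAt.hasDerivAt
  have hcb : Convex ℝ (Metric.ball (0:ℂ) R) := convex_ball _ _
  have b1 : ∀ z ∈ Metric.ball (0:ℂ) R, ‖deriv (deriv φ) z - deriv (deriv φ) a‖ ≤ K * ‖z - a‖ := fun z hz =>
    hcb.norm_image_sub_le_of_norm_hasDerivWithin_le (fun x hx => (d3 x hx).hasDerivWithinAt) hK ha hz
  have hconv : ∀ r : ℝ, Convex ℝ (Metric.ball (0:ℂ) R ∩ Metric.closedBall a r) := fun r => hcb.inter (convex_closedBall _ _)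
  have b2 : ∀ z ∈ Metric.ball (0:ℂ) R, ‖deriv φ z - deriv φ a - deriv (deriv φ) a * (z - a)‖ ≤ K * ‖z - a‖^2 := by
    intro z hz
    have := (hconv ‖z - a‖).norm_image_sub_le_of_norm_hasDerivWithin_le (f := fun y => deriv φ y - deriv (deriv φ) a * y)
      (f' := fun y => deriv (deriv φ) y - deriv (deriv φ) a * 1) (C := K * ‖z - a‖) (x := a) (y := z)
      (fun x hx => ((d2 x hx.1).sub ((hasDerivAt_id x).const_mul _)).hasDerivWithinAt)
      (fun x hx => by
        rw [mul_one]
        refine (b1 x hx.1).trans ?_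
        have := hx.2
        rw [mem_closedBall_iff_norm] at this
        gcongr) ⟨ha, by simp⟩ ⟨hz, by simp [dist_eq_norm]⟩
    calc _ = ‖deriv φ z - deriv (deriv φ) a * z - (deriv φ a - deriv (deriv φ) a * a)‖ := by congr 1; ring
      _ ≤ _ := this
      _ = _ := by ring
  refine ⟨b1 z hz, b2 z hz, ?_⟩
  have := (hconv ‖z - a‖).norm_image_sub_le_of_norm_hasDerivWithin_le (f := fun y => φ y - deriv φ a * y - deriv (deriv φ) a * (y - a)^2/2)
      (f' := fun y => deriv φ y - deriv φ a - deriv (deriv φ) a * (y - a)) (C := K * ‖z - a‖^2) (x := a) (y := z)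
      (fun x hx => by
        have h1 := ((d1 x hx.1).sub ((hasDerivAt_id x).const_mul (deriv φ a))).sub (((((hasDerivAt_id x).sub_const a).pow 2).const_mul (deriv (deriv φ) a)).div_const 2)
        refine HasDerivAt.hasDerivWithinAt ?_
        convert h1 using 1
        · rfl
        · simp; ring)
      (fun x hx => by
        refine (b2 x hx.1).trans ?_
        have := hx.2
        rw [mem_closedBall_iff_norm] at this
        gcongr) ⟨ha, by simp⟩ ⟨hz, by simp [dist_eq_norm]⟩
  calc _ = ‖φ z - deriv φ a * z - deriv (deriv φ) a * (z - a)^2/2 - (φ a - deriv φ a * a - deriv (deriv φ) a * (a - a)^2/2)‖ := by congr 1; ring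
      _ ≤ _ := this
      _ = _ := by ring

lemma exp_deriv_rel (φ M M1 M2 : ℂ → ℂ) (R : ℝ) (han : ∀ z ∈ Metric.ball (0:ℂ) R, AnalyticAt ℂ φ z)
    (hM : ∀ z ∈ Metric.ball (0:ℂ) R, Complex.exp (φ z) = M z)
    (h1 : ∀ z ∈ Metric.ball (0:ℂ) R, HasDerivAt M (M1 z) z)
    (h2 : ∀ z ∈ Metric.ball (0:ℂ) R, HasDerivAt M1 (M2 z) z) :
    ∀ z ∈ Metric.ball (0:ℂ) R, deriv φ z = M1 z / M z ∧ deriv (deriv φ) z = M2 z / M z - (M1 z / M z)^2 := by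
  have hM0 : ∀ z ∈ Metric.ball (0:ℂ) R, M z ≠ 0 := fun z hz => by rw [← hM z hz]; exact Complex.exp_ne_zero _
  have e1 : ∀ z ∈ Metric.ball (0:ℂ) R, deriv φ z = M1 z / M z := by
    intro z hz
    have ha := (han z hz).differentiableAt.hasDerivAt.cexp
    have hb : HasDerivAt (fun z => Complex.exp (φ z)) (M1 z) z := by
      refine (h1 z hz).congr_of_eventuallyEq ?_
      filter_upwards [Metric.isOpen_ball.mem_nhds hz] with y hy using hM y hy
    have := ha.unique hb
    rw [hM z hz] at this
    rw [eq_div_iff (hM0 z hz), ← this]; ring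
  intro z hz
  refine ⟨e1 z hz, ?_⟩
  have hd : HasDerivAt (deriv φ) ((M2 z * M z - M1 z * M1 z) / M z^2) z := by
    refine ((h2 z hz).div (h1 z hz) (hM0 z hz)).congr_of_eventuallyEq ?_
    filter_upwards [Metric.isOpen_ball.mem_nhds hz] with y hy using e1 y hy
  rw [hd.deriv]
  have := hM0 z hz
  field_simp

lemma mem_ball_tau {τ : ℝ} (hτ : 0 < τ) (z : ℂ) : z ∈ Metric.ball (0:ℂ) (1/τ) ↔ ‖z‖ * τ < 1 := by
  rw [mem_ball_zero_iff, lt_div_iff₀ hτ]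

lemma cgf_interior {φ : ℂ → ℂ} {τ : ℝ} {F : Measure ℝ} (hτ : 0 < τ) (h : IsCGF φ τ F) (a : ℝ) (ha : |a| * τ < 1) :
    a ∈ interior (integrableExpSet id F) := by
  have : Metric.ball (0:ℝ) (1/τ) ⊆ integrableExpSet id F := by
    intro y hy
    rw [mem_ball_zero_iff, lt_div_iff₀ hτ] at hy
    have h1 := (h.2 (y:ℂ) (by simpa using hy)).1.norm
    simp only [integrableExpSet, Set.mem_ofPred_eq]
    refine h1.congr (Filter.Eventually.of_forall fun x => ?_)
    simp [Complex.norm_exp]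
  apply interior_mono this
  rw [Metric.isOpen_ball.interior_eq, mem_ball_zero_iff, lt_div_iff₀ hτ]
  exact ha

lemma cgf_facts {φ : ℂ → ℂ} {τ σ : ℝ} {F : Measure ℝ} [IsProbabilityMeasure F] (hτ : 0 < τ)
    (hmean : (∫ x : ℝ, x ∂F) = 0) (hvar : variance id F = σ ^ 2) (h : IsCGF φ τ F) :
    (∀ z ∈ Metric.ball (0:ℂ) (1/τ), AnalyticAt ℂ φ z) ∧
    (∀ z ∈ Metric.ball (0:ℂ) (1/τ), ‖deriv (deriv (deriv φ)) z‖ ≤ τ * σ^2) ∧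
    deriv φ 0 = 0 ∧ deriv (deriv φ) 0 = (σ^2 : ℝ) ∧
    ∀ a : ℝ, |a| * τ < 1 → (deriv φ a).im = 0 ∧ (deriv (deriv φ) a).im = 0 ∧ mgf id F a = Real.exp (φ a).re := by
  have hb := mem_ball_tau hτ
  have han : ∀ z ∈ Metric.ball (0:ℂ) (1/τ), AnalyticAt ℂ φ z := fun z hz => (h.2 z ((hb z).mp hz)).2.2.1
  have hint : ∀ z ∈ Metric.ball (0:ℂ) (1/τ), z.re ∈ interior (integrableExpSet id F) := fun z hz => by
    apply cgf_interior hτ h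
    have := (hb z).mp hz
    have := Complex.abs_re_le_norm z
    nlinarith
  have hrel := exp_deriv_rel φ (fun z => ∫ x, ((id x : ℝ):ℂ)^0 * Complex.exp (z * (id x:ℝ)) ∂F) (fun z => ∫ x, ((id x : ℝ):ℂ)^1 * Complex.exp (z * (id x:ℝ)) ∂F)
    (fun z => ∫ x, ((id x : ℝ):ℂ)^2 * Complex.exp (z * (id x:ℝ)) ∂F) (1/τ) han
    (fun z hz => by simpa using (h.2 z ((hb z).mp hz)).2.1)
    (fun z hz => hasDerivAt_integral_pow_mul_exp (hint z hz) 0)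
    (fun z hz => hasDerivAt_integral_pow_mul_exp (hint z hz) 1)
  have hreal : ∀ (a : ℝ) (n : ℕ), (∫ x, ((id x : ℝ):ℂ)^n * Complex.exp (a * (id x:ℝ)) ∂F) = ((∫ x, x^n * Real.exp (a * x) ∂F : ℝ) : ℂ) := by
    intro a n
    rw [← integral_complex_ofReal]
    congr 1; ext x; push_cast; rfl
  have h0 : (0:ℂ) ∈ Metric.ball (0:ℂ) (1/τ) := by rw [hb]; simp
  have hm2 : ∫ x, x^2 ∂F = σ^2 := by
    rw [← hvar, variance_eq_integral aemeasurable_id]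
    simp [hmean]
  have hr0 := hrel 0 h0
  have e0 := hreal 0 0
  have e1 := hreal 0 1
  have e2 := hreal 0 2
  simp only [Complex.ofReal_zero] at e0 e1 e2
  simp only [e0, e1, e2] at hr0
  simp only [zero_mul, Real.exp_zero, mul_one, pow_zero, pow_one, hmean, hm2] at hr0
  refine ⟨han, ?_, by simpa using hr0.1, by simpa using hr0.2, ?_⟩
  · intro z hz
    have := (h.2 z ((hb z).mp hz)).2.2.2
    rwa [hvar, iteratedDeriv_succ, iteratedDeriv_succ, iteratedDeriv_one] at this
  · intro a ha
    have hab : (a:ℂ) ∈ Metric.ball (0:ℂ) (1/τ) := by rw [hb]; simpa using ha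
    obtain ⟨r1, r2⟩ := hrel a hab
    simp only [hreal] at r1 r2
    refine ⟨?_, ?_, ?_⟩
    · rw [r1, ← Complex.ofReal_div, Complex.ofReal_im]
    · rw [r2, ← Complex.ofReal_div, ← Complex.ofReal_div, ← Complex.ofReal_pow, ← Complex.ofReal_sub, Complex.ofReal_im]
    · have h1 := (h.2 a ((hb a).mp hab)).2.1
      have h2 := complexMGF_ofReal (X := id) (μ := F) a
      rw [complexMGF] at h2
      simp only [id] at h2
      rw [h2] at h1
      have h3 := congrArg norm h1
      rw [Complex.norm_exp, Complex.norm_real, Real.norm_eq_abs, abs_of_nonneg mgf_nonneg] at h3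
      exact h3.symm

def tiltG (F : Measure ℝ) (h x s : ℝ) : Measure ℝ := (F.tilted (fun y => h * id y)).map (fun y => (y - x) / s)

lemma tiltG_prob {φ : ℂ → ℂ} {τ : ℝ} {F : Measure ℝ} [IsProbabilityMeasure F] (hτ : 0 < τ) (hc : IsCGF φ τ F)
    (h x s : ℝ) (hh : |h| * τ < 1) : IsProbabilityMeasure (tiltG F h x s) ∧ Integrable (fun w => w) (tiltG F h x s) := by
  have hi := cgf_interior hτ hc h hh
  have hI : Integrable (fun y => Real.exp (h * id y)) F := by
    have := interior_subset hi
    exact this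
  have hp := isProbabilityMeasure_tilted hI
  have h1 := (memLp_tilted_mul hi 1).integrable (by simp)
  refine ⟨Measure.isProbabilityMeasure_map (by fun_prop), ?_⟩
  unfold tiltG
  rw [integrable_map_measure (by fun_prop) (by fun_prop)]
  exact (h1.sub (integrable_const x)).div_const s

lemma tiltG_charFun {φ : ℂ → ℂ} {τ : ℝ} {F : Measure ℝ} [IsProbabilityMeasure F] (hc : IsCGF φ τ F)
    (h x s t : ℝ) (hh : |h| * τ < 1) (hu : ‖(h + (t/s : ℝ) * Complex.I : ℂ)‖ * τ < 1) :
    charFun (tiltG F h x s) t = Complex.exp (φ (h + (t/s : ℝ) * Complex.I) - φ h - (t * x / s : ℝ) * Complex.I) := by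
  have e1 := (hc.2 h (by simpa using hh)).2.1
  have e2 := (hc.2 _ hu).2.1
  have h2 := complexMGF_ofReal (X := id) (μ := F) h
  rw [complexMGF] at h2
  simp only [id] at h2
  rw [h2] at e1
  rw [charFun_apply_real, tiltG, integral_map (by fun_prop) (by fun_prop), integral_tilted_mul_eq_mgf, Complex.exp_sub, Complex.exp_sub, e1, e2,
    ← integral_div, ← integral_div]
  congr 1; ext y
  rw [Complex.real_smul]
  push_cast
  rw [div_mul_eq_mul_div, ← Complex.exp_add, div_div, mul_comm (mgf id F h : ℂ), ← div_div, ← Complex.exp_sub]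
  congr 2
  simp only [id]
  ring

lemma tiltG_tail {φ : ℂ → ℂ} {F : Measure ℝ} [IsProbabilityMeasure F]
    (h x s : ℝ) (hs : 0 < s) (hm : mgf id F h = Real.exp (φ h).re) :
    F.real (Set.Ioi x) = Real.exp ((φ h).re - h * x) * ∫ w in Set.Ioi 0, Real.exp (-(h*s)*w) ∂(tiltG F h x s) := by
  rw [tiltG, setIntegral_map measurableSet_Ioi (by fun_prop) (by fun_prop)]
  have : (fun y => (y - x)/s) ⁻¹' (Set.Ioi 0) = Set.Ioi x := by
    ext y; simp [div_pos_iff_of_pos_right hs]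
  rw [this, setIntegral_tilted_mul_eq_mgf, hm, ← integral_const_mul]
  have h1 : F.real (Set.Ioi x) = ∫ y in Set.Ioi x, (1:ℝ) ∂F := by simp
  rw [h1]
  apply setIntegral_congr_fun measurableSet_Ioi
  intro y _
  simp only [smul_eq_mul, id]
  rw [← Real.exp_sub, ← Real.exp_add, ← Real.exp_add, eq_comm, Real.exp_eq_one_iff]
  field_simp
  ring

lemma char_close {φ : ℂ → ℂ} {τ σ : ℝ} {F : Measure ℝ} [IsProbabilityMeasure F] (hτ : 0 < τ) (hσ : 0 < σ)
    (hmean : (∫ x : ℝ, x ∂F) = 0) (hvar : variance id F = σ ^ 2) (hc : IsCGF φ τ F)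
    (h x s : ℝ) (hs : 0 < s) (hh : |h| * τ ≤ 1/4) (h1 : deriv φ h = x) (h2 : deriv (deriv φ) h = (s^2 : ℝ)) (hsσ : 7/10 * σ ≤ s)
    (t : ℝ) (ht : |t| ≤ σ / (12 * τ)) :
    ‖charFun (tiltG F h x s) t - ((Real.exp (-t^2/2) : ℝ) : ℂ)‖ ≤ (1/(σ / (12 * τ))) * |t|^3 * Real.exp (-t^2/4) := by
  obtain ⟨f1, f2, -, -, -⟩ := cgf_facts hτ hmean hvar hc
  have hab : (h:ℂ) ∈ Metric.ball (0:ℂ) (1/τ) := by rw [mem_ball_tau hτ]; simp; linarith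
  have htu : |t| / s * τ ≤ 1/4 := by
    rw [div_mul_eq_mul_div, div_le_iff₀ hs]
    rw [le_div_iff₀ (by positivity)] at ht
    linarith
  have hnorm : ‖((t/s : ℝ) * Complex.I : ℂ)‖ = |t|/s := by
    rw [norm_mul, Complex.norm_I, mul_one, Complex.norm_real, Real.norm_eq_abs, abs_div, abs_of_pos hs]
  have hu : ‖(h + (t/s : ℝ) * Complex.I : ℂ)‖ * τ < 1 := by
    have := norm_add_le (h:ℂ) ((t/s : ℝ) * Complex.I)
    rw [hnorm, Complex.norm_real, Real.norm_eq_abs] at this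
    nlinarith
  have hT := (taylor_cx φ (1/τ) (τ * σ^2) f1 f2 h _ hab ((mem_ball_tau hτ _).mpr hu)).2.2
  rw [tiltG_charFun hc h x s t (by linarith) hu]
  set R := φ (↑h + ↑(t / s) * Complex.I) - φ ↑h - deriv φ ↑h * (↑h + ↑(t / s) * Complex.I - ↑h) -
          deriv (deriv φ) ↑h * (↑h + ↑(t / s) * Complex.I - ↑h) ^ 2 / 2 with hR
  rw [add_sub_cancel_left, hnorm] at hT
  have hexp : φ (h + (t/s : ℝ) * Complex.I) - φ h - (t * x / s : ℝ) * Complex.I = ((-t^2/2 : ℝ) : ℂ) + R := by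
    rw [hR, h1, h2, add_sub_cancel_left]
    have : ((s:ℝ):ℂ) ≠ 0 := by exact_mod_cast hs.ne'
    rw [mul_pow, Complex.I_sq]
    push_cast
    field_simp
    ring
  rw [hexp, Complex.exp_add, Complex.ofReal_exp, ← mul_sub_one, norm_mul, ← Complex.ofReal_exp, Complex.norm_real, Real.norm_eq_abs, Real.abs_exp]
  have hs3 : 0.343 * σ^3 ≤ s^3 := by
    have : (7/10*σ)^3 ≤ s^3 := by gcongr
    nlinarith
  have hRb : ‖R‖ ≤ 3 * τ / σ * |t|^3 := by
    refine hT.trans ?_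
    have : τ * σ^2 * (|t|/s)^3 = τ * σ^2 / s^3 * |t|^3 := by rw [div_pow]; ring
    rw [this]
    gcongr ?_ * _
    rw [div_le_div_iff₀ (by positivity) hσ]
    have : 0 < τ := hτ
    nlinarith [pow_pos hσ 3, mul_le_mul_of_nonneg_left hs3 hτ.le, mul_pos hτ (pow_pos hσ 3)]
  have hRt : ‖R‖ ≤ t^2/4 := by
    refine hRb.trans ?_
    rw [le_div_iff₀ (by positivity)] at ht
    rw [← sq_abs t, div_mul_eq_mul_div, div_le_iff₀ hσ]
    nlinarith [mul_le_mul_of_nonneg_left ht (sq_nonneg |t|)]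
  have he : ‖Complex.exp R - 1‖ ≤ ‖R‖ * Real.exp ‖R‖ := by
    simpa using Complex.norm_exp_sub_sum_le_norm_mul_exp R 1
  calc _ ≤ Real.exp (-t^2/2) * (‖R‖ * Real.exp ‖R‖) := by gcongr
    _ = ‖R‖ * Real.exp (-t^2/2 + ‖R‖) := by rw [Real.exp_add]; ring
    _ ≤ (3 * τ / σ * |t|^3) * Real.exp (-t^2/4) := by
        gcongr
        linarith
    _ ≤ _ := by
        rw [one_div_div]
        gcongr
        norm_num

set_option maxHeartbeats 1000000 in
lemma saddle {φ : ℂ → ℂ} {τ σ : ℝ} {F : Measure ℝ} [IsProbabilityMeasure F] (hτ : 0 < τ) (hσ : 0 < σ)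
    (hmean : (∫ x : ℝ, x ∂F) = 0) (hvar : variance id F = σ ^ 2) (hc : IsCGF φ τ F) (x : ℝ) (hx : 0 < x) (hxτ : x * τ ≤ σ^2/16) :
    ∃ h s : ℝ, 0 ≤ h ∧ 0 < s ∧ |h| * τ ≤ 1/4 ∧ deriv φ h = x ∧ deriv (deriv φ) h = (s^2 : ℝ) ∧ 7/10 * σ ≤ s ∧
      mgf id F h = Real.exp (φ h).re ∧ |(φ h).re - h * x + (h*s)^2/2| ≤ 24 * (τ/σ) * (x/σ)^3 ∧ |x/σ - h * s| ≤ 8 * (τ/σ) * (x/σ)^2 := by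
  obtain ⟨f1, f2, f3, f4, f5⟩ := cgf_facts hτ hmean hvar hc
  have hσ2 : 0 < σ^2 := by positivity
  set b := 2 * x / σ^2 with hb
  have hb0 : 0 < b := by positivity
  have hbτ : b * τ ≤ 1/8 := by
    rw [hb, div_mul_eq_mul_div, div_le_iff₀ hσ2]; linarith
  have hmem : ∀ h ∈ Set.Icc 0 b, |h| * τ ≤ 1/8 := by
    intro h hh
    rw [abs_of_nonneg hh.1]
    nlinarith [hh.2]
  have hball : ∀ h ∈ Set.Icc 0 b, (h:ℂ) ∈ Metric.ball (0:ℂ) (1/τ) := by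
    intro h hh
    rw [mem_ball_tau hτ, Complex.norm_real, Real.norm_eq_abs]
    linarith [hmem h hh]
  have h0b : (0:ℂ) ∈ Metric.ball (0:ℂ) (1/τ) := by rw [mem_ball_tau hτ]; simp
  have htay : ∀ h ∈ Set.Icc 0 b, |(deriv (deriv φ) h).re - σ^2| ≤ τ * σ^2 * h ∧ |(deriv φ h).re - σ^2 * h| ≤ τ * σ^2 * h^2
      ∧ |(φ h).re - σ^2 * h^2/2| ≤ τ * σ^2 * h^3 := by
    intro h hh
    obtain ⟨t1, t2, t3⟩ := taylor_cx φ (1/τ) (τ * σ^2) f1 f2 0 h h0b (hball h hh)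
    rw [f3, f4, hc.1] at *
    simp only [sub_zero, Complex.norm_real, Real.norm_eq_abs, abs_of_nonneg hh.1, zero_mul] at t1 t2 t3
    refine ⟨?_, ?_, ?_⟩
    · refine le_trans ?_ ((Complex.abs_re_le_norm _).trans t1)
      simp only [Complex.sub_re, Complex.ofReal_re]; exact le_rfl
    · refine le_trans ?_ ((Complex.abs_re_le_norm _).trans t2)
      rw [← Complex.ofReal_mul]
      simp only [Complex.sub_re, Complex.ofReal_re]; exact le_rfl
    · refine le_trans ?_ ((Complex.abs_re_le_norm _).trans t3)
      have : ((σ^2 : ℝ):ℂ) * (h:ℂ)^2/2 = ((σ^2 * h^2/2 : ℝ):ℂ) := by push_cast; ring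
      rw [this]
      simp only [Complex.sub_re, Complex.ofReal_re]; exact le_rfl
  have hcont : ContinuousOn (fun h : ℝ => (deriv φ h).re) (Set.Icc 0 b) := by
    intro h hh
    have h1 : ContinuousAt (deriv φ) (h:ℂ) := (f1 _ (hball h hh)).deriv.continuousAt
    have h2 : ContinuousAt (fun h : ℝ => deriv φ (h:ℂ)) h := ContinuousAt.comp (f := fun h : ℝ => (h:ℂ)) h1 Complex.continuous_ofReal.continuousAt
    exact (Complex.continuous_re.continuousAt.comp h2).continuousWithinAt
  obtain ⟨h, hh, hhx⟩ : x ∈ Set.image (fun h : ℝ => (deriv φ h).re) (Set.Icc 0 b) := by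
    apply intermediate_value_Icc hb0.le hcont
    refine ⟨by simp [f3, hx.le], ?_⟩
    have := (abs_le.mp (htay b ⟨hb0.le, le_rfl⟩).2.1).1
    have e : σ^2 * b = 2 * x := by rw [hb]; field_simp
    have e2 : τ * σ^2 * b^2 = (b * τ) * (σ^2 * b) := by ring
    rw [e2, e] at this
    show x ≤ (deriv φ b).re
    nlinarith
  simp only at hhx
  have hh0 := hh.1
  have hhτ := hmem h hh
  obtain ⟨g1, g2, g3⟩ := f5 h (by linarith)
  obtain ⟨t1, t2, t3⟩ := htay h hh
  rw [abs_of_nonneg hh0] at hhτ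
  set q := (deriv (deriv φ) h).re with hq
  have hτσ : τ * σ^2 * h ≤ σ^2/8 := by nlinarith
  have hqlow : 7/8 * σ^2 ≤ q := by linarith [(abs_le.mp t1).1]
  have hqpos : 0 < q := by nlinarith
  have hsq : Real.sqrt q ^ 2 = q := Real.sq_sqrt hqpos.le
  have hs0 : 0 < Real.sqrt q := Real.sqrt_pos.mpr hqpos
  have hslow : 7/10 * σ ≤ Real.sqrt q := by
    apply Real.le_sqrt_of_sq_le; nlinarith
  -- normalized quantities
  have hH : h * σ ≤ 2 * (x/σ) := by
    have := hh.2
    rw [hb, le_div_iff₀ hσ2] at this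
    rw [mul_div_assoc', le_div_iff₀ hσ]; nlinarith
  have hH0 : 0 ≤ h * σ := by positivity
  have hε : 0 < τ/σ := by positivity
  have key3 : τ * σ^2 * h^3 = (τ/σ) * (h*σ)^3 := by field_simp
  have key2 : τ * σ^2 * h^2 = σ * ((τ/σ) * (h*σ)^2) := by field_simp
  have key1 : τ * σ^2 * h = σ * (σ * ((τ/σ) * (h * σ))) := by field_simp
  have hH3 : (h*σ)^3 ≤ 8 * (x/σ)^3 := by
    calc (h*σ)^3 ≤ (2 * (x/σ))^3 := by gcongr
      _ = _ := by ring
  have hH2 : (h*σ)^2 ≤ 4 * (x/σ)^2 := by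
    calc (h*σ)^2 ≤ (2 * (x/σ))^2 := by gcongr
      _ = _ := by ring
  refine ⟨h, Real.sqrt q, hh0, hs0, by rw [abs_of_nonneg hh0]; linarith, ?_, ?_, hslow, g3, ?_, ?_⟩
  · apply Complex.ext <;> simp [hhx, g1]
  · rw [hsq]; apply Complex.ext <;> simp [← hq, g2]
  · have e : (φ h).re - h * x + (h*Real.sqrt q)^2/2 = ((φ h).re - σ^2 * h^2/2) - h * (x - σ^2 * h) + h^2 * (q - σ^2)/2 := by
      rw [mul_pow, hsq]; ring
    rw [e]
    rw [hhx] at t2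
    have a2 : |h * (x - σ^2 * h)| ≤ τ * σ^2 * h^3 := by
      rw [abs_mul, abs_of_nonneg hh0]
      calc h * |x - σ^2 * h| ≤ h * (τ * σ^2 * h^2) := by gcongr
        _ = _ := by ring
    have a1 : |h^2 * (q - σ^2)/2| ≤ τ * σ^2 * h^3 := by
      rw [abs_div, abs_mul, abs_of_nonneg (sq_nonneg h), abs_two]
      calc h^2 * |q - σ^2| / 2 ≤ h^2 * (τ * σ^2 * h)/2 := by gcongr
        _ = (τ * σ^2 * h^3)/2 := by ring
        _ ≤ _ := by linarith [show 0 ≤ τ * σ^2 * h^3 by positivity]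
    have a3 : τ * σ^2 * h^3 ≤ (τ/σ) * (8 * (x/σ)^3) := by rw [key3]; gcongr
    have b1 := abs_le.mp a1
    have b2 := abs_le.mp a2
    have b3 := abs_le.mp t3
    rw [abs_le]; constructor <;> linarith [b1.1, b1.2, b2.1, b2.2, b3.1, b3.2, a3]
  · rw [hhx] at t2
    have c1 : |x/σ - h * σ| ≤ (τ/σ) * (h*σ)^2 := by
      have : x/σ - h * σ = (x - σ^2 * h)/σ := by field_simp
      rw [this, abs_div, abs_of_pos hσ, div_le_iff₀ hσ]
      rw [key2] at t2; linarith
    have c2 : |σ - Real.sqrt q| ≤ σ * ((τ/σ) * (h * σ)) := by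
      have e : q - σ^2 = (Real.sqrt q - σ) * (Real.sqrt q + σ) := by nlinarith
      rw [e, abs_mul, abs_of_pos (by positivity : 0 < Real.sqrt q + σ), abs_sub_comm, key1] at t1
      have : |σ - Real.sqrt q| * σ ≤ |σ - Real.sqrt q| * (Real.sqrt q + σ) := by gcongr; linarith
      nlinarith
    have c3 : |h * σ - h * Real.sqrt q| ≤ (τ/σ) * (h*σ)^2 := by
      rw [← mul_sub, abs_mul, abs_of_nonneg hh0]
      calc h * |σ - Real.sqrt q| ≤ h * (σ * ((τ/σ) * (h * σ))) := by gcongr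
        _ = _ := by ring
    have c4 : (τ/σ) * (h*σ)^2 ≤ (τ/σ) * (4 * (x/σ)^2) := by gcongr
    have := abs_sub_le (x/σ) (h*σ) (h * Real.sqrt q)
    linarith

set_option maxHeartbeats 2000000 in
lemma final_real (C C₂ : ℝ) (hC : 0 < C) (hC₂ : 0 < C₂) (hmills : ∀ κ : ℝ, 1 ≤ κ → Real.exp (-κ^2/2) ≤ C₂ * κ * gQ κ)
    (ε X κ r L : ℝ) (hε : 0 < ε) (hX : 2 ≤ X) (h1 : ε * X ≤ 1/16) (h2 : 72 * (C * C₂) * (ε * X) ≤ 1)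
    (h3 : 16 * (24 + 18 * (C * C₂)) * (ε * X) ≤ 1)
    (hr : |r| ≤ 24 * ε * X^3) (hκ : |X - κ| ≤ 8 * ε * X^2)
    (hL : |L - Real.exp (κ^2/2) * gQ κ| ≤ 24 * C * ε) :
    gQ (X + (8 + 4 * (24 + 18 * (C * C₂))) * ε * X^2) ≤ Real.exp (r - κ^2/2) * L ∧
    Real.exp (r - κ^2/2) * L ≤ gQ (X - (8 + 4 * (24 + 18 * (C * C₂))) * ε * X^2) := by
  have hX0 : 0 < X := by linarith
  obtain ⟨k1, k2⟩ := abs_le.mp hκ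
  have hE : 8 * ε * X^2 ≤ X/2 := by nlinarith
  have hκl : X/2 ≤ κ := by linarith
  have hκu : κ ≤ 3/2 * X := by linarith
  have hκ1 : 1 ≤ κ := by linarith
  have hQ := gQ_pos κ
  set D := C * C₂ with hD
  have hD0 : 0 < D := by positivity
  set C₄ := 24 + 18 * D with hC₄
  have hm := hmills κ hκ1
  set y := 24 * D * ε * κ with hy
  have hy0 : 0 ≤ y := by positivity
  have hyX : y ≤ 36 * D * (ε * X) := by
    rw [hy]
    have : 0 < D * ε := by positivity
    nlinarith
  have hyh : y ≤ 1/2 := by linarith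
  have hyX3 : y ≤ 9 * D * (ε * X^3) := by
    refine hyX.trans ?_
    have : ε * X * 4 ≤ ε * X^3 := by
      have : (4:ℝ) ≤ X^2 := by nlinarith
      nlinarith [mul_pos hε hX0]
    nlinarith
  -- main relative estimate
  have hrel : |Real.exp (-κ^2/2) * L - gQ κ| ≤ y * gQ κ := by
    have e : Real.exp (-κ^2/2) * L - gQ κ = Real.exp (-κ^2/2) * (L - Real.exp (κ^2/2) * gQ κ) := by
      rw [mul_sub, ← mul_assoc, ← Real.exp_add]
      have : -κ^2/2 + κ^2/2 = 0 := by ring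
      rw [this, Real.exp_zero, one_mul]
    rw [e, abs_mul, Real.abs_exp]
    calc _ ≤ (C₂ * κ * gQ κ) * (24 * C * ε) := by gcongr
      _ = _ := by rw [hy, hD]; ring
  have hP : Real.exp (r - κ^2/2) * L = Real.exp r * (Real.exp (-κ^2/2) * L) := by
    rw [← mul_assoc, ← Real.exp_add]; congr 2; ring
  obtain ⟨r1, r2⟩ := abs_le.mp hr
  obtain ⟨l1, l2⟩ := abs_le.mp hrel
  have hZ : C₄ * (ε * X^3) = 24 * ε * X^3 + 18 * D * (ε * X^3) := by rw [hC₄]; ring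
  have hup : Real.exp (r - κ^2/2) * L ≤ Real.exp (C₄ * (ε * X^3)) * gQ κ := by
    rw [hP]
    calc _ ≤ Real.exp r * ((1 + y) * gQ κ) := mul_le_mul_of_nonneg_left (by linarith) (Real.exp_pos r).le
      _ ≤ Real.exp r * (Real.exp y * gQ κ) := by gcongr; linarith [Real.add_one_le_exp y]
      _ = Real.exp (r + y) * gQ κ := by rw [Real.exp_add]; ring
      _ ≤ _ := by
        gcongr
        have : 0 < D * (ε * X^3) := by positivity
        linarith
  have hlow : Real.exp (-(C₄ * (ε * X^3))) * gQ κ ≤ Real.exp (r - κ^2/2) * L := by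
    rw [hP]
    have hexp : Real.exp (-(2*y)) ≤ 1 - y := by
      rw [Real.exp_neg]
      have h5 := Real.add_one_le_exp (2*y)
      have h6 : 1 ≤ (1 - y) * Real.exp (2*y) := by nlinarith
      rw [inv_le_iff_one_le_mul₀ (Real.exp_pos _)]
      exact h6
    calc _ ≤ Real.exp (r + -(2*y)) * gQ κ := by
          gcongr
          linarith
      _ = Real.exp r * (Real.exp (-(2*y)) * gQ κ) := by rw [Real.exp_add]; ring
      _ ≤ Real.exp r * ((1 - y) * gQ κ) := by gcongr
      _ ≤ _ := mul_le_mul_of_nonneg_left (by linarith) (Real.exp_pos r).le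
  have hC₄0 : 0 < C₄ := by positivity
  set δ := 4 * C₄ * ε * X^2 with hδ
  have hδ0 : 0 ≤ δ := by positivity
  have hδX : δ ≤ X/4 := by rw [hδ]; nlinarith
  constructor
  · refine le_trans ?_ hlow
    calc _ ≤ gQ (κ + δ) := by
          apply gQ_anti
          rw [hδ]; linarith
      _ ≤ Real.exp (-κ * δ) * gQ κ := gQ_shift (by linarith) hδ0
      _ ≤ _ := by
          gcongr
          have : X/4 * δ = C₄ * (ε * X^3) := by rw [hδ]; ring
          have h7 : X/4 * δ ≤ (κ) * δ := mul_le_mul_of_nonneg_right (by linarith) hδ0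
          linarith
  · refine hup.trans ?_
    have hs := gQ_shift (κ := κ - δ) (δ := δ) (by linarith) hδ0
    rw [sub_add_cancel] at hs
    calc _ ≤ Real.exp (C₄ * (ε * X^3)) * (Real.exp (-(κ - δ) * δ) * gQ (κ - δ)) := by gcongr
      _ = Real.exp (C₄ * (ε * X^3) + -(κ - δ) * δ) * gQ (κ - δ) := by rw [Real.exp_add]; ring
      _ ≤ 1 * gQ (κ - δ) := by
          have := (gQ_pos (κ - δ)).le
          gcongr
          rw [Real.exp_le_one_iff]
          have : X/4 * δ = C₄ * (ε * X^3) := by rw [hδ]; ring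
          have h7 : X/4 * δ ≤ (κ - δ) * δ := mul_le_mul_of_nonneg_right (by linarith) hδ0
          linarith
      _ = gQ (κ - δ) := one_mul _
      _ ≤ _ := by
          apply gQ_anti
          rw [hδ]; linarith

/-- Tail comparison lemma: there are absolute constants `c₉, c₁₀, c₁₁ > 0` such that if
`τ/σ ≤ c₉` then for `2σ ≤ x ≤ c₁₀ σ²/τ`, with `β(x) = c₁₁ τ x² σ⁻²`,
`1 - Φ(x + β(x)) ≤ 1 - F(x) ≤ 1 - Φ(x - β(x))`. -/
theorem tail_comparison_A1 :
    ∃ c₉ c₁₀ c₁₁ : ℝ, 0 < c₉ ∧ 0 < c₁₀ ∧ 0 < c₁₁ ∧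
      ∀ (τ σ : ℝ), 0 < τ → 0 < σ →
        ∀ (F : Measure ℝ), IsProbabilityMeasure F → (∫ x : ℝ, x ∂F) = 0 →
          variance id F = σ ^ 2 → MemA1 τ F → τ / σ ≤ c₉ →
          ∀ x : ℝ, 2 * σ ≤ x → x ≤ c₁₀ * σ ^ 2 / τ →
            1 - cdf (gaussianReal 0 (Real.toNNReal (σ ^ 2))) (x + c₁₁ * τ * x ^ 2 / σ ^ 2) ≤
              1 - cdf F x ∧
            1 - cdf F x ≤
              1 - cdf (gaussianReal 0 (Real.toNNReal (σ ^ 2))) (x - c₁₁ * τ * x ^ 2 / σ ^ 2) := by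
  obtain ⟨C, hC, hBE⟩ := berry_esseen
  obtain ⟨C₂, hC₂, hmills⟩ := gQ_mills
  have hD : 0 < C * C₂ := by positivity
  refine ⟨1, 1 / (16 * (24 + 18 * (C * C₂))), 8 + 4 * (24 + 18 * (C * C₂)), one_pos, by positivity, by positivity, ?_⟩
  intro τ σ hτ hσ F _ hmean hvar hmem _ x hx1 hx2
  obtain ⟨φ, hc⟩ := hmem
  have hx0 : 0 < x := by linarith
  have hεX : τ/σ * (x/σ) ≤ 1 / (16 * (24 + 18 * (C * C₂))) := by
    rw [le_div_iff₀ hτ] at hx2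
    rw [div_mul_div_comm, div_le_iff₀ (by positivity)]
    nlinarith
  have h3 : 16 * (24 + 18 * (C * C₂)) * (τ/σ * (x/σ)) ≤ 1 := by
    rw [le_div_iff₀ (by positivity)] at hεX; linarith
  have hpos : 0 < τ/σ * (x/σ) := by positivity
  have hDp : 0 < C * C₂ * (τ/σ * (x/σ)) := by positivity
  have h1 : τ/σ * (x/σ) ≤ 1/16 := by nlinarith
  have h2 : 72 * (C * C₂) * (τ/σ * (x/σ)) ≤ 1 := by nlinarith
  have hxτ : x * τ ≤ σ^2/16 := by
    rw [div_mul_div_comm, div_le_iff₀ (by positivity)] at h1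
    nlinarith
  obtain ⟨h, s, hh0, hs, hhτ, hd1, hd2, hsσ, hmgf, hr, hκ⟩ := saddle hτ hσ hmean hvar hc x hx0 hxτ
  obtain ⟨hGp, hGi⟩ := tiltG_prob hτ hc h x s (by linarith)
  have hTpos : 0 < σ / (12 * τ) := by positivity
  have hbe := hBE (tiltG F h x s) hGi (σ / (12 * τ)) hTpos
    (fun t ht => char_close hτ hσ hmean hvar hc h x s hs hhτ hd1 hd2 hsσ t ht)
  have hX2 : 2 ≤ x/σ := by rw [le_div_iff₀ hσ]; exact hx1
  have hκpos : 0 < h * s := by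
    have := (abs_le.mp hκ).2
    nlinarith
  have hL := laplace_close (tiltG F h x s) (gaussianReal 0 1) hκpos hbe
  rw [gQ_laplace] at hL
  have hL' : |∫ w in Set.Ioi 0, Real.exp (-(h*s)*w) ∂(tiltG F h x s) - Real.exp ((h*s)^2/2) * gQ (h*s)| ≤ 24 * C * (τ/σ) := by
    refine hL.trans (le_of_eq ?_)
    field_simp; ring
  have hfin := final_real C C₂ hC hC₂ hmills (τ/σ) (x/σ) (h*s) _ _ (by positivity) hX2 h1 h2 h3 hr hκ hL'
  rw [gauss_scale hσ, gauss_scale hσ, one_sub_cdf, tiltG_tail h x s hs hmgf]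
  have e : (φ h).re - h * x + (h*s)^2/2 - (h*s)^2/2 = (φ h).re - h * x := by ring
  rw [e] at hfin
  have e1 : (x + (8 + 4 * (24 + 18 * (C * C₂))) * τ * x^2/σ^2)/σ = x/σ + (8 + 4 * (24 + 18 * (C * C₂))) * (τ/σ) * (x/σ)^2 := by
    field_simp
  have e2 : (x - (8 + 4 * (24 + 18 * (C * C₂))) * τ * x^2/σ^2)/σ = x/σ - (8 + 4 * (24 + 18 * (C * C₂))) * (τ/σ) * (x/σ)^2 := by
    field_simp
  rw [e1, e2]
  exact hfin
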